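/- arXiv:2103.02850 — 4 statements merged into one kernel-verified Lean document; each statement's English description precedes it below -/
import Mathlib

section
/- Let X be a finite subset and Y a nonempty finite subset of a real inner product space, and let ŷ ∈ Y. Suppose that for every x ∈ X there exists y ∈ Y with y ≠ ŷ and ‖x − y‖ < ‖x − ŷ‖ (i.e., ŷ is never a strict nearest neighbor of any point of X). Then the one-directional Chamfer loss as a function of the position of ŷ, namely z ↦ ∑_{x∈X} min_{y ∈ (Y \ {ŷ}) ∪ {z}} ‖x − y‖², is constant on some neighborhood of ŷ; in particular it is differentiable at ŷ with derivative zero, so ŷ is an isolated point that receives no gradient from CD_{X→Y}. -/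
open Filter Topology

/-- **Isolated points of the `X → Y` Chamfer loss.** If `yhat ∈ Y` is never a strict
nearest neighbor of any point of `X` (for every `x ∈ X` there is some other
`y ∈ Y` strictly closer to `x`), then the one-directional Chamfer loss, as a
function of the position of `yhat`, is locally constant around `yhat`; in particular
it has derivative `0` at `yhat`, so `yhat` receives no gradient from `CD_{X→Y}`. -/
theorem chamfer_isolated_point {E : Type*} [NormedAddCommGroup E] [InnerProductSpace ℝ E]
    [DecidableEq E] (X Y : Finset E) (hY : Y.Nonempty) (yhat : E) (hyhat : yhat ∈ Y)
    (h : ∀ x ∈ X, ∃ y ∈ Y, y ≠ yhat ∧ ‖x - y‖ < ‖x - yhat‖) :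
    (∀ᶠ z in 𝓝 yhat,
        (∑ x ∈ X, (insert z (Y.erase yhat)).inf' (Finset.insert_nonempty _ _)
            (fun y => ‖x - y‖ ^ 2))
          = ∑ x ∈ X, (insert yhat (Y.erase yhat)).inf' (Finset.insert_nonempty _ _)
            (fun y => ‖x - y‖ ^ 2))
    ∧ HasFDerivAt
        (fun z => ∑ x ∈ X, (insert z (Y.erase yhat)).inf' (Finset.insert_nonempty _ _)
          (fun y => ‖x - y‖ ^ 2))
        (0 : E →L[ℝ] ℝ) yhat := by
  have key : ∀ x ∈ X, ∀ z : E, (∃ y ∈ Y, y ≠ yhat ∧ ‖x - y‖ < ‖x - z‖) →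
      ∀ hne : (Y.erase yhat).Nonempty,
      (insert z (Y.erase yhat)).inf' (Finset.insert_nonempty _ _) (fun y => ‖x - y‖ ^ 2)
        = (Y.erase yhat).inf' hne (fun y => ‖x - y‖ ^ 2) := by
    intro x _ z hz hne
    obtain ⟨y, hy, hyne, hlt⟩ := hz
    rw [Finset.inf'_insert hne]
    apply inf_eq_right.mpr
    refine (Finset.inf'_le (fun y => ‖x - y‖ ^ 2) (Finset.mem_erase.mpr ⟨hyne, hy⟩)).trans ?_
    exact pow_le_pow_left₀ (norm_nonneg _) hlt.le 2
  have ev : ∀ᶠ z in 𝓝 yhat, ∀ x ∈ X, ∃ y ∈ Y, y ≠ yhat ∧ ‖x - y‖ < ‖x - z‖ := by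
    rw [Filter.eventually_all_finset]
    intro x hx
    obtain ⟨y, hy, hyne, hlt⟩ := h x hx
    have hc : Continuous fun z : E => ‖x - z‖ := by fun_prop
    filter_upwards [hc.continuousAt.eventually (lt_mem_nhds hlt)] with z hz
    exact ⟨y, hy, hyne, hz⟩
  have main : ∀ᶠ z in 𝓝 yhat,
        (∑ x ∈ X, (insert z (Y.erase yhat)).inf' (Finset.insert_nonempty _ _)
            (fun y => ‖x - y‖ ^ 2))
          = ∑ x ∈ X, (insert yhat (Y.erase yhat)).inf' (Finset.insert_nonempty _ _)
            (fun y => ‖x - y‖ ^ 2) := by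
    filter_upwards [ev] with z hz
    refine Finset.sum_congr rfl fun x hx => ?_
    obtain ⟨y, hy, hyne, _⟩ := h x hx
    have hne : (Y.erase yhat).Nonempty := ⟨y, Finset.mem_erase.mpr ⟨hyne, hy⟩⟩
    rw [key x hx z (hz x hx) hne, key x hx yhat (h x hx) hne]
  exact ⟨main, (hasFDerivAt_const _ yhat).congr_of_eventuallyEq main⟩
end

section
/- Let X be a nonempty finite subset of a real inner product space and let ŷ be a point having a unique strict nearest neighbor x* ∈ X, i.e., ‖ŷ − x*‖ < ‖ŷ − x‖ for every x ∈ X with x ≠ x*. Then the function f(y) = min_{x∈X} ‖y − x‖² is differentiable at ŷ and its gradient at ŷ equals 2(ŷ − x*). Consequently, the partial derivative of the Y→X part of the Chamfer distance with respect to a reconstructed point ŷ is 2(ŷ − x*), where x* is ŷ's nearest neighbor in the ground truth X. -/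
/-- **Gradient of the `Y → X` Chamfer term.** If `yhat` has a unique strict nearest
neighbor `xstar` in the finite nonempty set `X`, then `f y = min_{x ∈ X} ‖y - x‖²`
is differentiable at `yhat` with gradient `2 (yhat - xstar)`. -/
theorem chamfer_Y2X_gradient {E : Type*} [NormedAddCommGroup E] [InnerProductSpace ℝ E]
    [CompleteSpace E] (X : Finset E) (hX : X.Nonempty) (xstar : E) (hxstar : xstar ∈ X)
    (yhat : E) (h : ∀ x ∈ X, x ≠ xstar → ‖yhat - xstar‖ < ‖yhat - x‖) :
    HasGradientAt (fun y => X.inf' hX (fun x => ‖y - x‖ ^ 2))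
      ((2 : ℝ) • (yhat - xstar)) yhat := by
  have hev : (fun y => X.inf' hX (fun x => ‖y - x‖ ^ 2)) =ᶠ[nhds yhat]
      (fun y => ‖y - xstar‖ ^ 2) := by
    have h1 : ∀ᶠ y in nhds yhat, ∀ x ∈ X, ‖y - xstar‖ ≤ ‖y - x‖ := by
      rw [Filter.eventually_all_finset]
      intro x hx
      by_cases hxx : x = xstar
      · subst hxx
        exact Filter.Eventually.of_forall fun y => le_refl _
      · have hc1 : Continuous fun y : E => ‖y - xstar‖ := by fun_prop
        have hc2 : Continuous fun y : E => ‖y - x‖ := by fun_prop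
        exact (hc1.continuousAt.eventually_lt hc2.continuousAt (h x hx hxx)).mono
          fun y hy => le_of_lt hy
    filter_upwards [h1] with y hy
    apply le_antisymm
    · exact Finset.inf'_le (fun x => ‖y - x‖ ^ 2) hxstar
    · apply Finset.le_inf'
      intro x hx
      exact pow_le_pow_left₀ (norm_nonneg _) (hy x hx) 2
  rw [hasGradientAt_iff_hasFDerivAt]
  refine HasFDerivAt.congr_of_eventuallyEq ?_ hev
  have h2 := ((hasFDerivAt_id (𝕜 := ℝ) yhat).sub_const xstar).norm_sq
  have h3 : (InnerProductSpace.toDual ℝ E) ((2 : ℝ) • (yhat - xstar)) =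
      2 • (innerSL ℝ (id yhat - xstar)).comp (ContinuousLinearMap.id ℝ E) := by
    ext v
    simp [inner_smul_left, inner_sub_left, two_smul]
    try ring
  rw [h3]
  exact h2
end

section
/- Let x₁, …, xₙ be points in a real normed vector space, let k be a fixed index, and suppose xᵢ ≠ x_k for all i ≠ k. For y distinct from all the xᵢ, define the weighted average A(y) = (∑ᵢ ‖xᵢ − y‖⁻¹ · xᵢ) / (∑ᵢ ‖xᵢ − y‖⁻¹). Then A(y) tends to x_k as y tends to x_k through points distinct from all xᵢ. That is, when the distance from ŷ to one ground-truth point x_k tends to zero, the inverse-square-root-weighted target of the gradient of PED (with spatial field g(t) = 1/√t, whose resulting weight k(d) is proportional to the inverse distance) converges to x_k. -/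
open Filter Topology

/-- **Fast convergence of the PED gradient target.** Let `x 1, …, x n` be points in
a real normed vector space, `k` a fixed index with `x i ≠ x k` for `i ≠ k`. For `y`
distinct from all the `x i`, the inverse-distance-weighted average
`A y = (∑ i, ‖x i - y‖⁻¹ • x i) / (∑ i, ‖x i - y‖⁻¹)` tends to `x k` as `y` tends
to `x k` through points distinct from all `x i`. -/
theorem weighted_average_tendsto {E : Type*} [NormedAddCommGroup E] [NormedSpace ℝ E]
    (n : ℕ) (x : Fin n → E) (k : Fin n) (hx : ∀ i, i ≠ k → x i ≠ x k) :
    Filter.Tendsto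
      (fun y => (∑ i, ‖x i - y‖⁻¹)⁻¹ • ∑ i, ‖x i - y‖⁻¹ • x i)
      (𝓝[{y | ∀ i, y ≠ x i}] (x k)) (𝓝 (x k)) := by
  have hmem : ∀ᶠ y in 𝓝[{y | ∀ i, y ≠ x i}] (x k), ‖x k - y‖ ≠ 0 := by
    filter_upwards [self_mem_nhdsWithin] with y hy
    exact norm_ne_zero_iff.mpr (sub_ne_zero.mpr (hy k).symm)
  have hd : ∀ i, Tendsto (fun y => ‖x i - y‖) (𝓝[{y | ∀ i, y ≠ x i}] (x k))
      (𝓝 ‖x i - x k‖) := fun i =>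
    ((continuous_const.sub continuous_id).norm.tendsto (x k)).mono_left nhdsWithin_le_nhds
  have hw : ∀ i, Tendsto (fun y => ‖x k - y‖ * ‖x i - y‖⁻¹)
      (𝓝[{y | ∀ i, y ≠ x i}] (x k)) (𝓝 (if i = k then 1 else 0)) := by
    intro i
    by_cases h : i = k
    · subst h
      rw [if_pos rfl]
      refine tendsto_const_nhds.congr' ?_
      filter_upwards [hmem] with y hy
      exact (mul_inv_cancel₀ hy).symm
    · rw [if_neg h]
      have h0 : ‖x i - x k‖ ≠ 0 := norm_ne_zero_iff.mpr (sub_ne_zero.mpr (hx i h))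
      simpa using (hd k).mul ((hd i).inv₀ h0)
  have h1 := tendsto_finsetSum Finset.univ (fun i _ => hw i)
  have h2 := tendsto_finsetSum Finset.univ (fun i _ => (hw i).smul_const (x i))
  simp only [Finset.sum_ite_eq', Finset.mem_univ, if_true, ite_smul, one_smul, zero_smul] at h1 h2
  have h3 := (h1.inv₀ one_ne_zero).smul h2
  rw [inv_one, one_smul] at h3
  refine h3.congr' ?_
  filter_upwards [hmem] with y hy
  simp only [mul_smul]
  rw [← Finset.mul_sum, ← Finset.smul_sum, mul_inv, mul_comm, smul_smul, mul_assoc,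
    inv_mul_cancel₀ hy, mul_one]
end

section
/- Let x₀, x₁, x₁′ be points in a real inner product space with Δ = ‖x₁ − x₁′‖, and suppose ‖x₁ − x₁′‖ ≤ ‖x₁ − x₀‖ and ‖x₁′ − x₁‖ ≤ ‖x₁′ − x₀‖ (so that under nearest-neighbor matching x₀ is matched with x₀ and x₁ with x₁′). Then the Chamfer distance between the two-point clouds P₁ = {x₀, x₁} and P₂ = {x₀, x₁′} equals 2Δ². In particular the Chamfer distance between such two-point clouds depends only on the magnitude Δ of the perturbation and not on the direction of the perturbation or the location of the perturbed point, so the Chamfer distance cannot distinguish isometric distortions. -/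
/-- **The Chamfer distance cannot distinguish isometric distortions.** For points
`x₀, x₁, x₁'` with `Δ = ‖x₁ - x₁'‖`, if `‖x₁ - x₁'‖ ≤ ‖x₁ - x₀‖` and
`‖x₁' - x₁‖ ≤ ‖x₁' - x₀‖` (so that under nearest-neighbor matching `x₀` is matched
with `x₀` and `x₁` with `x₁'`), the Chamfer distance between the two-point clouds
`{x₀, x₁}` and `{x₀, x₁'}` equals `2 Δ²`: it depends only on the magnitude of the
perturbation, not its direction or location. -/
theorem chamfer_isometric_indistinguishable {E : Type*} [NormedAddCommGroup E]
    [InnerProductSpace ℝ E] [DecidableEq E] (x₀ x₁ x₁' : E)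
    (h₁ : ‖x₁ - x₁'‖ ≤ ‖x₁ - x₀‖) (h₂ : ‖x₁' - x₁‖ ≤ ‖x₁' - x₀‖) :
    ((∑ p ∈ ({x₀, x₁} : Finset E),
        ({x₀, x₁'} : Finset E).inf' (Finset.insert_nonempty _ _) (fun q => ‖p - q‖ ^ 2))
      + ∑ q ∈ ({x₀, x₁'} : Finset E),
        ({x₀, x₁} : Finset E).inf' (Finset.insert_nonempty _ _) (fun p => ‖p - q‖ ^ 2))
    = 2 * ‖x₁ - x₁'‖ ^ 2 := by
  by_cases h : x₁ = x₁'
  · subst h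
    have key : ∀ p ∈ ({x₀, x₁} : Finset E), ∀ f : E → ℝ, f p = 0 → (∀ q, 0 ≤ f q) →
        ({x₀, x₁} : Finset E).inf' (Finset.insert_nonempty _ _) f = 0 := by
      intro p hp f hf hn
      apply le_antisymm
      · rw [← hf]
        exact Finset.inf'_le f hp
      · exact Finset.le_inf' _ _ (fun q _ => hn q)
    rw [Finset.sum_eq_zero (fun p hp => key p hp _ (by simp) (fun q => by positivity)),
      Finset.sum_eq_zero (fun p hp => key p hp _ (by simp) (fun q => by positivity))]
    simp
  · have hpos : 0 < ‖x₁ - x₁'‖ := norm_pos_iff.mpr (sub_ne_zero.mpr h)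
    have n1 : x₀ ≠ x₁ := by
      rintro rfl
      rw [sub_self, norm_zero] at h₁
      linarith
    have n2 : x₀ ≠ x₁' := by
      rintro rfl
      rw [sub_self, norm_zero, norm_sub_rev] at h₂
      linarith
    rw [norm_sub_rev x₁' x₁, norm_sub_rev x₁' x₀] at h₂
    have e1 : ‖x₁ - x₁'‖ ^ 2 ≤ ‖x₁ - x₀‖ ^ 2 := by gcongr
    have e2 : ‖x₁ - x₁'‖ ^ 2 ≤ ‖x₀ - x₁'‖ ^ 2 := by gcongr
    have e3 : (0 : ℝ) ≤ ‖x₀ - x₁'‖ ^ 2 := by positivity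
    have e4 : (0 : ℝ) ≤ ‖x₁ - x₀‖ ^ 2 := by positivity
    rw [Finset.sum_pair n1, Finset.sum_pair n2]
    simp only [Finset.inf'_insert, Finset.inf'_singleton, Finset.singleton_nonempty, sub_self,
      norm_zero, ne_eq, OfNat.ofNat_ne_zero, not_false_eq_true, zero_pow]
    rw [inf_eq_left.mpr e3, inf_eq_left.mpr e4, inf_eq_right.mpr e1, inf_eq_right.mpr e2]
    ring
end
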